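/- arXiv:2408.10399 — 6 statements merged into one kernel-verified Lean document; each statement's English description precedes it below -/
import Mathlib

section
/- Let 0 ≤ φ′ ≤ φ ≤ φ″ ≤ π and ψ ∈ [0, π]. If φ″ ≤ π/2, then v(φ, ψ) ≤ (cos((φ″ − φ′)/2))^{−1} · max(v(φ′, ψ), v(φ″, ψ)). -/
open Real

/-- `v(φ, ψ) = cos φ − cos(φ + ψ)` if `φ + ψ ≤ π`, and `cos φ + 1` otherwise. -/
noncomputable def v (φ ψ : ℝ) : ℝ :=
  if φ + ψ ≤ π then Real.cos φ - Real.cos (φ + ψ) else Real.cos φ + 1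

lemma cos_sub_cos_add_le_v (φ ψ : ℝ) : cos φ - cos (φ + ψ) ≤ v φ ψ := by
  unfold v
  split_ifs
  · exact le_rfl
  · linarith [neg_one_le_cos (φ + ψ)]

lemma v_nonneg {φ ψ : ℝ} (hφ : 0 ≤ φ) (hψ : 0 ≤ ψ) : 0 ≤ v φ ψ := by
  unfold v
  split_ifs with h
  · exact sub_nonneg.2 (cos_le_cos_of_nonneg_of_le_pi hφ h (by linarith))
  · linarith [neg_one_le_cos φ]

lemma cos_half_sub_mul_sin_le_max {a x b : ℝ} (ha : 0 ≤ a) (hax : a ≤ x) (hxb : x ≤ b)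
    (hb : b ≤ π) : cos ((b - a) / 2) * sin x ≤ max (sin a) (sin b) := by
  have hx : 0 ≤ sin x := sin_nonneg_of_nonneg_of_le_pi (by linarith) (by linarith)
  have hd : 0 ≤ cos ((b - a) / 2) := cos_nonneg_of_mem_Icc ⟨by linarith, by linarith⟩
  have h₁ : cos ((b - a) / 2) * sin x ≤ sin x := mul_le_of_le_one_left hx (cos_le_one _)
  have h₂ : cos ((b - a) / 2) * sin x ≤ cos ((b - a) / 2) :=
    mul_le_of_le_one_right hd (sin_le_one _)
  rcases le_total b (π / 2) with hb' | hb'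
  · exact le_max_of_le_right
      (h₁.trans (sin_le_sin_of_le_of_le_pi_div_two (by linarith) hb' hxb))
  rcases le_total (π / 2) a with ha' | ha'
  · refine le_max_of_le_left (h₁.trans ?_)
    rw [← sin_pi_sub x, ← sin_pi_sub a]
    exact sin_le_sin_of_le_of_le_pi_div_two (by linarith) (by linarith) (by linarith)
  rcases le_total (a + b) π with hab | hab
  · refine le_max_of_le_right (h₂.trans ?_)
    rw [← cos_sub_pi_div_two b]
    exact cos_le_cos_of_nonneg_of_le_pi (by linarith) (by linarith) (by linarith)
  · refine le_max_of_le_left (h₂.trans ?_)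
    rw [← cos_pi_div_two_sub a]
    exact cos_le_cos_of_nonneg_of_le_pi (by linarith) (by linarith) (by linarith)

lemma cos_sub_cos_add (x ψ : ℝ) :
    cos x - cos (x + ψ) = 2 * sin (ψ / 2) * sin (x + ψ / 2) := by
  rw [cos_sub_cos, show (x + (x + ψ)) / 2 = x + ψ / 2 by ring,
    show (x - (x + ψ)) / 2 = -(ψ / 2) by ring, sin_neg]
  ring

lemma cos_half_sub_mul_le_max_v {φ' φ φ'' ψ : ℝ} (h0 : 0 ≤ φ') (h1 : φ' ≤ φ) (h2 : φ ≤ φ'')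
    (hψ : ψ ∈ Set.Icc 0 π) (h : φ'' ≤ π / 2) :
    cos ((φ'' - φ') / 2) * (cos φ - cos (φ + ψ)) ≤ max (v φ' ψ) (v φ'' ψ) := by
  obtain ⟨hψ₀, hψ₁⟩ := hψ
  have hs : 0 ≤ 2 * sin (ψ / 2) :=
    mul_nonneg zero_le_two (sin_nonneg_of_nonneg_of_le_pi (by linarith) (by linarith))
  have key := cos_half_sub_mul_sin_le_max (a := φ' + ψ / 2) (x := φ + ψ / 2) (b := φ'' + ψ / 2)
    (by linarith) (by linarith) (by linarith) (by linarith)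
  rw [add_sub_add_right_eq_sub] at key
  calc cos ((φ'' - φ') / 2) * (cos φ - cos (φ + ψ))
      = 2 * sin (ψ / 2) * (cos ((φ'' - φ') / 2) * sin (φ + ψ / 2)) := by
        rw [cos_sub_cos_add]; ring
    _ ≤ 2 * sin (ψ / 2) * max (sin (φ' + ψ / 2)) (sin (φ'' + ψ / 2)) :=
        mul_le_mul_of_nonneg_left key hs
    _ = max (cos φ' - cos (φ' + ψ)) (cos φ'' - cos (φ'' + ψ)) := by
        rw [mul_max_of_nonneg _ _ hs, cos_sub_cos_add, cos_sub_cos_add]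
    _ ≤ max (v φ' ψ) (v φ'' ψ) :=
        max_le_max (cos_sub_cos_add_le_v _ _) (cos_sub_cos_add_le_v _ _)

theorem v_le_of_le_pi_div_two (φ' φ φ'' ψ : ℝ)
    (h0 : 0 ≤ φ') (h1 : φ' ≤ φ) (h2 : φ ≤ φ'') (h3 : φ'' ≤ π)
    (hψ : ψ ∈ Set.Icc 0 π) (h : φ'' ≤ π / 2) :
    v φ ψ ≤ (Real.cos ((φ'' - φ') / 2))⁻¹ * max (v φ' ψ) (v φ'' ψ) := by
  have hd : 0 < cos ((φ'' - φ') / 2) :=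
    cos_pos_of_mem_Ioo ⟨by linarith [pi_pos], by linarith [pi_pos]⟩
  rw [le_inv_mul_iff₀ hd]
  by_cases hφ : φ + ψ ≤ π
  · rw [v, if_pos hφ]
    exact cos_half_sub_mul_le_max_v h0 h1 h2 hψ h
  have hvφ : v φ ψ = cos φ + 1 := if_neg hφ
  by_cases hφ' : φ' + ψ ≤ π
  · have hc : cos φ ≤ cos (π - ψ) :=
      cos_le_cos_of_nonneg_of_le_pi (by linarith [hψ.2]) (by linarith) (by linarith)
    have key := cos_half_sub_mul_le_max_v (φ := π - ψ) h0 (by linarith) (by linarith) hψ h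
    rw [sub_add_cancel, cos_pi, sub_neg_eq_add] at key
    refine le_trans (mul_le_mul_of_nonneg_left ?_ hd.le) key
    rw [hvφ]
    linarith
  · refine le_max_of_le_left
      ((mul_le_of_le_one_left (v_nonneg (h0.trans h1) hψ.1) (cos_le_one _)).trans ?_)
    rw [hvφ, v, if_neg hφ']
    gcongr
    exact cos_le_cos_of_nonneg_of_le_pi h0 (by linarith) h1
end

section
/- Let 0 ≤ φ′ ≤ φ ≤ φ″ ≤ π and ψ ∈ [0, π]. If φ′ ≥ π/2, then v(φ, ψ) ≤ v(φ′, ψ). -/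
open Real

theorem cos_sub_cos_add_le {a b ψ : ℝ} (hψ : 0 ≤ ψ) (ha : π / 2 ≤ a) (hab : a ≤ b)
    (hb : b + ψ ≤ π) : cos b - cos (b + ψ) ≤ cos a - cos (a + ψ) := by
  have key (x : ℝ) : cos x - cos (x + ψ) = 2 * cos (x + ψ / 2 - π / 2) * sin (ψ / 2) := by
    rw [cos_sub_cos, cos_sub_pi_div_two, show (x + (x + ψ)) / 2 = x + ψ / 2 by ring,
      show (x - (x + ψ)) / 2 = -(ψ / 2) by ring, sin_neg]
    ring
  rw [key, key]
  have hs : 0 ≤ sin (ψ / 2) := sin_nonneg_of_nonneg_of_le_pi (by linarith) (by linarith)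
  have hc : cos (b + ψ / 2 - π / 2) ≤ cos (a + ψ / 2 - π / 2) :=
    cos_le_cos_of_nonneg_of_le_pi (by linarith) (by linarith) (by linarith)
  gcongr

theorem v_le_of_pi_div_two_le (φ' φ φ'' ψ : ℝ)
    (h0 : 0 ≤ φ') (h1 : φ' ≤ φ) (h2 : φ ≤ φ'') (h3 : φ'' ≤ π)
    (hψ : ψ ∈ Set.Icc 0 π) (h : π / 2 ≤ φ') :
    v φ ψ ≤ v φ' ψ := by
  have hcos {x : ℝ} (hx : φ' ≤ x) (hxφ : x ≤ φ) : cos φ ≤ cos x :=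
    cos_le_cos_of_nonneg_of_le_pi (h0.trans hx) (h2.trans h3) hxφ
  unfold v
  split_ifs with hφ hφ' hφ'
  · exact cos_sub_cos_add_le hψ.1 h h1 hφ
  · linarith
  · have hmid := cos_sub_cos_add_le (b := π - ψ) hψ.1 h (by linarith) (by linarith)
    rw [sub_add_cancel, cos_pi] at hmid
    linarith [hcos (x := π - ψ) (by linarith) (by linarith)]
  · linarith [hcos le_rfl h1]
end

section
/- For all real numbers x and y, one has cos x − cos(x + y) ≤ v(2π‖x/(2π)‖, 2π‖y/(2π)‖). -/
open Real

/-- The distance from a real number to the nearest integer. -/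
noncomputable def distNearestInt (x : ℝ) : ℝ := |x - round x|

/-- Every real number is congruent modulo `2π` to one of absolute value `2π‖x/(2π)‖`. -/
lemma exists_eq_add_int_mul_two_pi (x : ℝ) :
    ∃ (t : ℝ) (n : ℤ), x = t + n * (2 * π) ∧ 2 * π * distNearestInt (x / (2 * π)) = |t| := by
  refine ⟨2 * π * (x / (2 * π) - round (x / (2 * π))), round (x / (2 * π)), ?_, ?_⟩
  · have := Real.pi_ne_zero
    rw [mul_sub, mul_div_cancel₀ x (by positivity)]
    ring
  · rw [abs_mul, abs_of_pos Real.two_pi_pos, distNearestInt]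

theorem cos_sub_cos_le_v (x y : ℝ) :
    Real.cos x - Real.cos (x + y) ≤
      v (2 * π * distNearestInt (x / (2 * π))) (2 * π * distNearestInt (y / (2 * π))) := by
  obtain ⟨s, m, hx, hs⟩ := exists_eq_add_int_mul_two_pi x
  obtain ⟨t, n, hy, ht⟩ := exists_eq_add_int_mul_two_pi y
  have hcos : Real.cos x = Real.cos |s| := by
    rw [hx, Real.cos_add_int_mul_two_pi, Real.cos_abs]
  have hsum : Real.cos (x + y) = Real.cos |s + t| := by
    rw [Real.cos_abs, ← Real.cos_add_int_mul_two_pi (s + t) (m + n), hx, hy]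
    congr 1
    push_cast
    ring
  rw [hs, ht, v, hcos]
  split_ifs with h
  · have := Real.cos_le_cos_of_nonneg_of_le_pi (abs_nonneg _) h (abs_add_le s t)
    linarith
  · linarith [Real.neg_one_le_cos (x + y)]
end

section
/- Let N ≥ 1, θ ∈ ℝ^N, T > 0, and let P′ ⊆ [−1/2, 1/2)^N be a Lebesgue measurable set. Then ∫_{v ∈ [0,1)^N} λ₁({t ∈ [0, T] : t·θ ∈ v + P′ + ℤ^N}) dλ_N(v) = T · λ_N(P′), where λ₁ and λ_N denote 1-dimensional and N-dimensional Lebesgue measure. In particular, there exists v ∈ ℝ^N such that λ₁({t ∈ [0, T] : t·θ ∈ v + P′ + ℤ^N}) ≥ T · λ_N(P′). -/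
open MeasureTheory

/-- The union `P + ℤ^ι` of all integer translates of a set `P`. -/
def integerTranslates {ι : Type*} (P : Set (ι → ℝ)) : Set (ι → ℝ) :=
  {x | ∃ m : ι → ℤ, ∃ p ∈ P, ∀ i, x i = p i + (m i : ℝ)}

theorem integerTranslates_eq_iUnion {ι : Type*} (P : Set (ι → ℝ)) :
    integerTranslates P = ⋃ m : ι → ℤ, (fun x i => x i - (m i : ℝ)) ⁻¹' P := by
  ext x
  simp only [integerTranslates, Set.mem_ofPred_eq, Set.mem_iUnion, Set.mem_preimage]
  refine exists_congr fun m => ⟨?_, fun h => ⟨_, h, fun i => by simp⟩⟩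
  rintro ⟨p, hp, h⟩
  have : (fun i => x i - (m i : ℝ)) = p := funext fun i => by rw [h i]; ring
  rwa [this]

theorem measurableSet_integerTranslates {ι : Type*} [Finite ι] {P : Set (ι → ℝ)}
    (hP : MeasurableSet P) : MeasurableSet (integerTranslates P) := by
  rw [integerTranslates_eq_iUnion]
  exact MeasurableSet.iUnion fun m => hP.preimage (by fun_prop)

theorem sub_intCast_mem_integerTranslates {ι : Type*} {P : Set (ι → ℝ)} {x : ι → ℝ}
    (hx : x ∈ integerTranslates P) (k : ι → ℤ) :
    (fun i => x i - (k i : ℝ)) ∈ integerTranslates P := by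
  obtain ⟨m, p, hp, h⟩ := hx
  exact ⟨m - k, p, hp, fun i => by
    simp only [h i, Pi.sub_apply]; push_cast; ring⟩

theorem sub_intCast_mem_integerTranslates_iff {ι : Type*} {P : Set (ι → ℝ)} {x : ι → ℝ}
    (k : ι → ℤ) :
    (fun i => x i - (k i : ℝ)) ∈ integerTranslates P ↔ x ∈ integerTranslates P :=
  ⟨fun h => by simpa using sub_intCast_mem_integerTranslates h (-k),
    fun h => sub_intCast_mem_integerTranslates h k⟩

/-- A subset of the cube `[-1/2, 1/2)^ι` is recovered from its integer translates. -/
theorem integerTranslates_inter_cube {ι : Type*} {P : Set (ι → ℝ)}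
    (hP : P ⊆ {x | ∀ i, x i ∈ Set.Ico (-(1 / 2) : ℝ) (1 / 2)}) :
    integerTranslates P ∩ {x | ∀ i, x i ∈ Set.Ico (-(1 / 2) : ℝ) (1 / 2)} = P := by
  refine Set.Subset.antisymm ?_ fun x hx => ⟨⟨0, x, hx, by simp⟩, hP hx⟩
  rintro x ⟨⟨m, p, hp, h⟩, hx⟩
  have hxp : x = p := funext fun i => by
    have hxi := hx i
    have hpi := hP hp i
    rw [h i] at hxi
    have h₁ : (m i : ℝ) < 1 := by linarith [hxi.2, hpi.1]
    have h₂ : (-1 : ℝ) < m i := by linarith [hxi.1, hpi.2]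
    have h₃ : m i = 0 := by
      have h₁' : m i < 1 := by exact_mod_cast h₁
      have h₂' : -1 < m i := by exact_mod_cast h₂
      omega
    rw [h i, h₃]
    simp
  rwa [hxp]

theorem measurableSet_unitCube {ι : Type*} [Finite ι] :
    MeasurableSet {v : ι → ℝ | ∀ i, v i ∈ Set.Ico (0 : ℝ) 1} := by
  have : {v : ι → ℝ | ∀ i, v i ∈ Set.Ico (0 : ℝ) 1} = Set.univ.pi fun _ => Set.Ico (0 : ℝ) 1 := by
    ext; simp
  rw [this]
  exact MeasurableSet.univ_pi fun _ => measurableSet_Ico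

theorem volume_unitCube {ι : Type*} [Fintype ι] :
    volume {v : ι → ℝ | ∀ i, v i ∈ Set.Ico (0 : ℝ) 1} = 1 := by
  have : {v : ι → ℝ | ∀ i, v i ∈ Set.Ico (0 : ℝ) 1} = Set.univ.pi fun _ => Set.Ico (0 : ℝ) 1 := by
    ext; simp
  rw [this, volume_pi_pi]
  simp

/-- Reflecting and translating `P + ℤ^ι` does not change the measure of its trace on the unit
cube. -/
theorem volume_sub_mem_integerTranslates_inter_unitCube {ι : Type*} [Fintype ι] {P : Set (ι → ℝ)}
    (hPm : MeasurableSet P) (hP : P ⊆ {x | ∀ i, x i ∈ Set.Ico (-(1 / 2) : ℝ) (1 / 2)})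
    (a : ι → ℝ) :
    volume ((fun v => a - v) ⁻¹' integerTranslates P ∩
      {v : ι → ℝ | ∀ i, v i ∈ Set.Ico (0 : ℝ) 1}) = volume P := by
  let L := (Submodule.span ℤ (Set.range (Pi.basisFun ℝ ι))).toAddSubgroup
  have : Countable L :=
    inferInstanceAs (Countable (Submodule.span ℤ (Set.range (Pi.basisFun ℝ ι))))
  have hD : IsAddFundamentalDomain L {v : ι → ℝ | ∀ i, v i ∈ Set.Ico (0 : ℝ) 1} volume := by
    have h := ZSpan.isAddFundamentalDomain' (Pi.basisFun ℝ ι) volume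
    rw [ZSpan.fundamentalDomain_pi_basisFun] at h
    convert h using 1
    ext; simp
  let b : ι → ℝ := a + fun _ => 1 / 2
  have hD' : IsAddFundamentalDomain L
      ((fun v => b - v) ⁻¹' {v : ι → ℝ | ∀ i, v i ∈ Set.Ico (0 : ℝ) 1}) volume :=
    hD.preimage_of_equiv (Measure.measurePreserving_sub_left volume b).quasiMeasurePreserving
      (e := Neg.neg) neg_involutive.bijective fun g v => by
        ext i
        simp only [AddSubgroup.vadd_def, vadd_eq_add, AddSubgroup.coe_neg, Pi.add_apply,
          Pi.sub_apply, Pi.neg_apply]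
        ring
  have hinv : ∀ g : L, (fun v => g +ᵥ v) ⁻¹' ((fun v => a - v) ⁻¹' integerTranslates P) =
      (fun v => a - v) ⁻¹' integerTranslates P := by
    intro g
    have hg := (Module.Basis.mem_span_iff_repr_mem ℤ (Pi.basisFun ℝ ι) (g : ι → ℝ)).1 g.2
    choose k hk using hg
    ext v
    simp only [Set.mem_preimage]
    rw [← sub_intCast_mem_integerTranslates_iff (x := a - v) k]
    convert Iff.rfl using 2
    ext i
    have hki : (k i : ℝ) = (g : ι → ℝ) i := by simpa using hk i
    simp only [AddSubgroup.vadd_def, vadd_eq_add, Pi.add_apply, Pi.sub_apply, hki]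
    ring
  rw [hD.measure_set_eq hD'
    ((measurableSet_integerTranslates hPm).preimage (by fun_prop)) hinv]
  have hcube : (fun v => b - v) ⁻¹' {v : ι → ℝ | ∀ i, v i ∈ Set.Ico (0 : ℝ) 1} =
      (fun v => a - v) ⁻¹' {x : ι → ℝ | ∀ i, x i ∈ Set.Ico (-(1 / 2) : ℝ) (1 / 2)} := by
    ext v
    refine forall_congr' fun i => ?_
    simp only [b, Set.mem_Ico, Pi.sub_apply, Pi.add_apply]
    constructor <;> rintro ⟨h₁, h₂⟩ <;> constructor <;> linarith
  rw [hcube, ← Set.preimage_inter, integerTranslates_inter_cube hP]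
  exact (Measure.measurePreserving_sub_left volume a).measure_preimage hPm.nullMeasurableSet

theorem integral_measure_of_shifted_orbit (N : ℕ) (hN : 1 ≤ N) (θ : Fin N → ℝ)
    (T : ℝ) (hT : 0 < T) (P' : Set (Fin N → ℝ)) (hP'meas : MeasurableSet P')
    (hP'sub : P' ⊆ {x : Fin N → ℝ | ∀ i, x i ∈ Set.Ico (-(1 / 2) : ℝ) (1 / 2)}) :
    (∫ v in {v : Fin N → ℝ | ∀ i, v i ∈ Set.Ico (0 : ℝ) 1},
        (volume {t : ℝ | t ∈ Set.Icc 0 T ∧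
          ∃ m : Fin N → ℤ, ∃ p ∈ P', ∀ i, t * θ i = v i + p i + (m i : ℝ)}).toReal) =
      T * (volume P').toReal ∧
    ∃ v : Fin N → ℝ,
      (volume {t : ℝ | t ∈ Set.Icc 0 T ∧
          ∃ m : Fin N → ℤ, ∃ p ∈ P', ∀ i, t * θ i = v i + p i + (m i : ℝ)}).toReal ≥
        T * (volume P').toReal := by
  set D : Set (Fin N → ℝ) := {v : Fin N → ℝ | ∀ i, v i ∈ Set.Ico (0 : ℝ) 1} with hD
  let S : Set ((Fin N → ℝ) × ℝ) := (fun q => q.2 • θ - q.1) ⁻¹' integerTranslates P'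
  have hS : MeasurableSet S := (measurableSet_integerTranslates hP'meas).preimage (by fun_prop)
  have hfiber (v : Fin N → ℝ) : volume {t : ℝ | t ∈ Set.Icc 0 T ∧
      ∃ m : Fin N → ℤ, ∃ p ∈ P', ∀ i, t * θ i = v i + p i + (m i : ℝ)} =
      volume.restrict (Set.Icc 0 T) (Prod.mk v ⁻¹' S) := by
    rw [Measure.restrict_apply (hS.preimage (by fun_prop)), Set.inter_comm]
    congr 1
    ext t
    refine and_congr_right fun _ => exists_congr fun m => exists_congr fun p =>
      and_congr_right fun _ => forall_congr' fun i => ?_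
    simp only [Pi.sub_apply, Pi.smul_apply, smul_eq_mul]
    rw [sub_eq_iff_eq_add', add_assoc]
  simp only [hfiber]
  have hmeas : Measurable fun v => volume.restrict (Set.Icc 0 T) (Prod.mk v ⁻¹' S) :=
    measurable_measure_prodMk_left hS
  have hlint : ∫⁻ v in D, volume.restrict (Set.Icc 0 T) (Prod.mk v ⁻¹' S) =
      ENNReal.ofReal T * volume P' := by
    rw [← Measure.prod_apply hS, Measure.prod_apply_symm hS]
    have (t : ℝ) : volume.restrict D ((fun v => (v, t)) ⁻¹' S) = volume P' := by
      rw [Measure.restrict_apply (hS.preimage (by fun_prop))]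
      exact volume_sub_mem_integerTranslates_inter_unitCube hP'meas hP'sub (t • θ)
    simp only [this, lintegral_const, Measure.restrict_apply_univ, Real.volume_Icc, sub_zero]
    rw [mul_comm]
  have hP'fin : volume P' ≠ ⊤ := by
    rw [← volume_sub_mem_integerTranslates_inter_unitCube hP'meas hP'sub 0]
    exact measure_ne_top_of_subset Set.inter_subset_right (by rw [volume_unitCube]; simp)
  have hint : ∫ v in D, (volume.restrict (Set.Icc 0 T) (Prod.mk v ⁻¹' S)).toReal =
      T * (volume P').toReal := by
    rw [integral_toReal hmeas.aemeasurable (ae_of_all _ fun v => measure_lt_top _ _), hlint,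
      ENNReal.toReal_mul, ENNReal.toReal_ofReal hT.le]
  refine ⟨hint, ?_⟩
  have : IsProbabilityMeasure (volume.restrict D) := ⟨by
    rw [Measure.restrict_apply_univ, hD, volume_unitCube]⟩
  obtain ⟨v, hv⟩ := exists_integral_le (integrable_toReal_of_lintegral_ne_top
    (μ := volume.restrict D) hmeas.aemeasurable
    (by rw [hlint]; exact ENNReal.mul_ne_top ENNReal.ofReal_ne_top hP'fin))
  exact ⟨v, hint ▸ hv⟩
end

section
/- Let N ≥ 1, let v₁, …, v_N be a basis of ℝ^N, and let P = {Σ_{k=1}^N t_k v_k : t_k ∈ [−1/2, 1/2] for all k} be the (centered) fundamental parallelotope of the lattice Λ = {Σ_{k=1}^N λ_k v_k : λ_k ∈ ℤ}. Let d₁, …, d_N be positive numbers such that ±v₁ ± ⋯ ± v_N ∈ D := ∏_{n=1}^N [−d_n, d_n] for every choice of ± signs. Let η ∈ ℝ^N, let A ⊆ [−1/2, 1/2]^N be compact, let A′ = {v ∈ A : v + (3/2)·D ⊆ A}, and let L = {v ∈ Λ : v + D ⊆ η + A}. Then η + A′ ⊆ ∪_{v ∈ L} (v + P); consequently L is finite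 and #L · vol(P) ≥ vol(A′), where vol denotes N-dimensional Lebesgue measure. -/
open MeasureTheory

/-- If all signed sums of the reals `w k` are at most `D`, then so is the sum of their absolute
values. -/
lemma sum_abs_le_of_signed_sums_le {ι : Type*} [Fintype ι] (w : ι → ℝ) {D : ℝ}
    (h : ∀ ε : ι → ℝ, (∀ k, ε k = 1 ∨ ε k = -1) → ∑ k, ε k * w k ≤ D) : ∑ k, |w k| ≤ D := by
  classical
  refine le_trans (le_of_eq (Finset.sum_congr rfl fun k _ => ?_))
    (h (fun k => if 0 ≤ w k then 1 else -1) fun k => by split_ifs <;> simp)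
  split_ifs with hk
  · simp [abs_of_nonneg hk]
  · simp [abs_of_neg (not_le.mp hk)]

/-- A combination with coefficients in `[-1/2, 1/2]` has absolute value at most half the sum of the
absolute values. -/
lemma abs_sum_mul_le_half {ι : Type*} [Fintype ι] (t w : ι → ℝ)
    (ht : ∀ k, t k ∈ Set.Icc (-(1 / 2) : ℝ) (1 / 2)) :
    |∑ k, t k * w k| ≤ (∑ k, |w k|) / 2 := by
  refine (Finset.abs_sum_le_sum_abs _ _).trans ?_
  rw [Finset.sum_div]
  refine Finset.sum_le_sum fun k _ => ?_
  rw [abs_mul]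
  have := abs_le.mpr (ht k)
  nlinarith [abs_nonneg (w k)]

/-- If finitely many translates `x + P`, `x ∈ L`, cover `η + S`, then `S` has volume at most
`#L * vol P`. -/
lemma toReal_volume_le_ncard_mul_of_translates_cover {N : ℕ} {L P S : Set (Fin N → ℝ)}
    (hL : L.Finite) (hP : volume P ≠ ⊤) (η : Fin N → ℝ)
    (h : ∀ z ∈ S, ∃ x ∈ L, ∃ p ∈ P, η + z = x + p) :
    (volume S).toReal ≤ (L.ncard : ℝ) * (volume P).toReal := by
  have hsub : S ⊆ ⋃ x ∈ hL.toFinset, (fun z => z + (η - x)) ⁻¹' P := fun z hz => by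
    obtain ⟨x, hx, p, hp, hzp⟩ := h z hz
    have : z + (η - x) = p := by
      rw [← add_sub_assoc, add_comm z, hzp, add_sub_cancel_left]
    simp only [Set.mem_iUnion]
    exact ⟨x, hL.mem_toFinset.mpr hx, by simpa only [Set.mem_preimage, this] using hp⟩
  have hle : volume S ≤ (L.ncard : ENNReal) * volume P := by
    calc volume S ≤ ∑ x ∈ hL.toFinset, volume ((fun z => z + (η - x)) ⁻¹' P) :=
          (measure_mono hsub).trans (measure_biUnion_finset_le _ _)
      _ = (L.ncard : ENNReal) * volume P := by
          simp only [measure_preimage_add_right, Finset.sum_const, nsmul_eq_mul,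
            Set.ncard_eq_toFinset_card L hL]
  simpa using ENNReal.toReal_mono (ENNReal.mul_ne_top (ENNReal.natCast_ne_top _) hP) hle

theorem tiles_cover_inner_set (N : ℕ) (hN : 1 ≤ N) (v : Fin N → (Fin N → ℝ))
    (hvli : LinearIndependent ℝ v)
    (hvspan : Submodule.span ℝ (Set.range v) = ⊤)
    (d : Fin N → ℝ) (hd : ∀ n, 0 < d n)
    (hD : ∀ ε : Fin N → ℝ, (∀ k, ε k = 1 ∨ ε k = -1) →
      (∑ k, ε k • v k) ∈ {x : Fin N → ℝ | ∀ n, x n ∈ Set.Icc (-(d n)) (d n)})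
    (η : Fin N → ℝ) (A : Set (Fin N → ℝ)) (hA : IsCompact A)
    (hAsub : A ⊆ {x : Fin N → ℝ | ∀ n, x n ∈ Set.Icc (-(1 / 2) : ℝ) (1 / 2)}) :
    -- `P` is the centered fundamental parallelotope, `L` the set of lattice points `x`
    -- with `x + D ⊆ η + A`, and `A′ = {x ∈ A : x + (3/2)·D ⊆ A}`.
    (∀ z ∈ {x ∈ A | ∀ y ∈ {x : Fin N → ℝ | ∀ n, x n ∈ Set.Icc (-(d n)) (d n)},
        x + (3 / 2 : ℝ) • y ∈ A},
      ∃ x ∈ {x : Fin N → ℝ | (∃ m : Fin N → ℤ, x = ∑ k, (m k : ℝ) • v k) ∧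
          ∀ y ∈ {x : Fin N → ℝ | ∀ n, x n ∈ Set.Icc (-(d n)) (d n)}, ∃ a ∈ A, x + y = η + a},
        ∃ p ∈ {x : Fin N → ℝ | ∃ t : Fin N → ℝ,
            (∀ k, t k ∈ Set.Icc (-(1 / 2) : ℝ) (1 / 2)) ∧ x = ∑ k, t k • v k},
          η + z = x + p) ∧
    {x : Fin N → ℝ | (∃ m : Fin N → ℤ, x = ∑ k, (m k : ℝ) • v k) ∧
        ∀ y ∈ {x : Fin N → ℝ | ∀ n, x n ∈ Set.Icc (-(d n)) (d n)},
          ∃ a ∈ A, x + y = η + a}.Finite ∧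
    (volume {x ∈ A | ∀ y ∈ {x : Fin N → ℝ | ∀ n, x n ∈ Set.Icc (-(d n)) (d n)},
        x + (3 / 2 : ℝ) • y ∈ A}).toReal ≤
      ({x : Fin N → ℝ | (∃ m : Fin N → ℤ, x = ∑ k, (m k : ℝ) • v k) ∧
          ∀ y ∈ {x : Fin N → ℝ | ∀ n, x n ∈ Set.Icc (-(d n)) (d n)},
            ∃ a ∈ A, x + y = η + a}.ncard : ℝ) *
        (volume {x : Fin N → ℝ | ∃ t : Fin N → ℝ,
            (∀ k, t k ∈ Set.Icc (-(1 / 2) : ℝ) (1 / 2)) ∧ x = ∑ k, t k • v k}).toReal := by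
  have hP : ∀ t : Fin N → ℝ, (∀ k, t k ∈ Set.Icc (-(1 / 2) : ℝ) (1 / 2)) →
      ∀ n, |(∑ k, t k • v k) n| ≤ d n / 2 := fun t ht n => by
    have hs : ∑ k, |v k n| ≤ d n := sum_abs_le_of_signed_sums_le _ fun ε hε => by
      simpa using (hD ε hε n).2
    have := abs_sum_mul_le_half t (fun k => v k n) ht
    simp only [Finset.sum_apply, Pi.smul_apply, smul_eq_mul]
    linarith
  let b : Module.Basis (Fin N) ℝ (Fin N → ℝ) := Module.Basis.mk hvli hvspan.ge
  have hb : ∀ k, b k = v k := fun k => by simp [b]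
  have and_intro : ∀ {p q r : Prop}, p → q → (p → q → r) → p ∧ q ∧ r :=
    fun hp hq hr => ⟨hp, hq, hr hp hq⟩
  refine and_intro ?_ ?_ fun hcover hfin =>
    toReal_volume_le_ncard_mul_of_translates_cover hfin ?_ η hcover
  · rintro z ⟨-, hzA⟩
    set c := b.repr (η + z) with hc
    have hsum : η + z = ∑ k, (round (c k) : ℝ) • v k + ∑ k, (c k - round (c k)) • v k := by
      rw [← Finset.sum_add_distrib]
      conv_lhs => rw [← b.sum_repr (η + z)]
      exact Finset.sum_congr rfl fun k _ => by rw [hb, ← add_smul, add_sub_cancel]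
    have ht : ∀ k, c k - round (c k) ∈ Set.Icc (-(1 / 2) : ℝ) (1 / 2) := fun k =>
      abs_le.mp (abs_sub_round (c k))
    have hp := hP _ ht
    set p := ∑ k, (c k - round (c k)) • v k
    refine ⟨_, ⟨⟨_, rfl⟩, fun y hy => ?_⟩, p, ⟨_, ht, rfl⟩, hsum⟩
    refine ⟨z + (3 / 2 : ℝ) • ((2 / 3 : ℝ) • (y - p)), hzA _ fun n => ?_, ?_⟩
    · have h1 := hy n
      have h2 := abs_le.mp (hp n)
      simp only [Pi.smul_apply, Pi.sub_apply, smul_eq_mul, Set.mem_Icc] at h1 ⊢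
      constructor <;> linarith [h1.1, h1.2, h2.1, h2.2]
    · rw [smul_smul, ← add_assoc, hsum]
      norm_num
  · have hbdd : Bornology.IsBounded ((fun a => η + a) '' A) :=
      (hA.image (continuous_const.add continuous_id)).isBounded
    refine (ZSpan.setFinite_inter b hbdd).subset ?_
    rintro x ⟨⟨m, rfl⟩, hx⟩
    refine ⟨?_, ?_⟩
    · obtain ⟨a, ha, hxa⟩ := hx 0 fun n => by simpa using (hd n).le
      exact ⟨a, ha, by simpa using hxa.symm⟩
    · refine Submodule.sum_mem _ fun k _ => ?_
      rw [Int.cast_smul_eq_zsmul, ← hb]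
      exact Submodule.smul_mem _ _ (Submodule.subset_span ⟨k, rfl⟩)
  · refine ((measure_mono ?_).trans_lt
      (isCompact_Icc (a := fun n => -(d n / 2)) (b := fun n => d n / 2)).measure_lt_top).ne
    rintro _ ⟨t, ht, rfl⟩
    exact ⟨fun n => (abs_le.mp (hP t ht n)).1, fun n => (abs_le.mp (hP t ht n)).2⟩
end

section
/- Let y > 0 and let T₁, T₂ be real numbers with e ≤ T₁ ≤ T₂. Then ∫_{T₁}^∞ log(t/(2π)) / (t·e^{t y}) dt ≤ (1/2)·e^{−T₁ y}·((log T₂)² − (log T₁)²) + e^{−T₂ y}·(log T₂)/(T₂ y). -/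
open Real MeasureTheory

theorem integral_log_div_self {a b : ℝ} (ha : 0 < a) (hab : a ≤ b) :
    ∫ t in a..b, Real.log t / t = (Real.log b ^ 2 - Real.log a ^ 2) / 2 := by
  have hpos : ∀ t ∈ Set.uIcc a b, t ≠ 0 := fun t ht => by
    rw [Set.uIcc_of_le hab] at ht
    exact (ha.trans_le ht.1).ne'
  rw [intervalIntegral.integral_eq_sub_of_hasDerivAt (f := fun t => Real.log t ^ 2 / 2)]
  · ring
  · intro t ht
    refine (((Real.hasDerivAt_log (hpos t ht)).pow 2).div_const 2).congr_deriv ?_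
    simp only [Nat.cast_ofNat, Nat.add_one_sub_one, pow_one]
    ring
  · refine ContinuousOn.intervalIntegrable ?_
    exact (Real.continuousOn_log.mono hpos).div continuousOn_id hpos

theorem log_div_two_pi_div_mul_exp_le {t : ℝ} (ht : 0 < t) (y : ℝ) :
    Real.log (t / (2 * π)) / (t * Real.exp (t * y)) ≤ Real.log t / t * Real.exp (-y * t) := by
  have h : Real.log (t / (2 * π)) ≤ Real.log t :=
    Real.log_le_log (by positivity) (div_le_self ht.le (by linarith [Real.pi_gt_three]))
  have heq : Real.log t / t * Real.exp (-y * t) = Real.log t / (t * Real.exp (t * y)) := by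
    rw [show -y * t = -(t * y) by ring, Real.exp_neg]
    field_simp
  rw [heq]
  gcongr

theorem integral_log_div_mul_exp_le (y T₁ T₂ : ℝ) (hy : 0 < y)
    (hT₁ : Real.exp 1 ≤ T₁) (hT : T₁ ≤ T₂) :
    ∫ t in Set.Ici T₁, Real.log (t / (2 * π)) / (t * Real.exp (t * y)) ≤
      (1 / 2) * Real.exp (-(T₁ * y)) * ((Real.log T₂) ^ 2 - (Real.log T₁) ^ 2) +
        Real.exp (-(T₂ * y)) * Real.log T₂ / (T₂ * y) := by
  have h1 : 1 ≤ T₁ := (Real.one_le_exp zero_le_one).trans hT₁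
  have hpos : 0 < T₁ := by linarith
  have hpos₂ : 0 < T₂ := by linarith
  have hlog : 0 ≤ Real.log T₁ := Real.log_nonneg h1
  have hlog₂ : Real.log T₁ ≤ Real.log T₂ := Real.log_le_log hpos hT
  rw [integral_Ici_eq_integral_Ioi]
  by_cases hf : IntegrableOn (fun t => Real.log (t / (2 * π)) / (t * Real.exp (t * y)))
      (Set.Ioi T₁)
  swap
  · rw [integral_undef hf]
    have hsq : 0 ≤ Real.log T₂ ^ 2 - Real.log T₁ ^ 2 := by nlinarith
    have : 0 ≤ Real.log T₂ := hlog.trans hlog₂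
    positivity
  rw [← Set.Ioc_union_Ioi_eq_Ioi hT] at hf ⊢
  rw [setIntegral_union Set.Ioc_disjoint_Ioi_same measurableSet_Ioi hf.left_of_union
    hf.right_of_union]
  refine add_le_add ?_ ?_
  · have hint : IntegrableOn (fun t => Real.log t / t * Real.exp (-(T₁ * y)))
        (Set.Ioc T₁ T₂) := by
      have hne : ∀ t ∈ Set.Icc T₁ T₂, t ≠ 0 := fun t ht => (hpos.trans_le ht.1).ne'
      refine (ContinuousOn.integrableOn_Icc ?_).mono_set Set.Ioc_subset_Icc_self
      exact ((Real.continuousOn_log.mono hne).div continuousOn_id hne).mul continuousOn_const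
    refine (setIntegral_mono_on hf.left_of_union hint measurableSet_Ioc fun t ht => ?_).trans_eq ?_
    · have ht0 : 0 < t := hpos.trans ht.1
      have : 0 ≤ Real.log t := Real.log_nonneg (h1.trans ht.1.le)
      refine (log_div_two_pi_div_mul_exp_le ht0 y).trans ?_
      gcongr
      nlinarith [ht.1]
    · rw [integral_mul_const, ← intervalIntegral.integral_of_le hT,
        integral_log_div_self hpos hT]
      ring
  · have hint : IntegrableOn (fun t => Real.log T₂ / T₂ * Real.exp (-y * t)) (Set.Ioi T₂) :=
      (integrableOn_exp_mul_Ioi (neg_lt_zero.mpr hy) T₂).const_mul _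
    refine (setIntegral_mono_on hf.right_of_union hint measurableSet_Ioi
      fun t ht => ?_).trans_eq ?_
    · have ht' : T₂ < t := ht
      refine (log_div_two_pi_div_mul_exp_le (hpos₂.trans ht') y).trans ?_
      exact mul_le_mul_of_nonneg_right (Real.log_div_self_antitoneOn (hT₁.trans hT)
        ((hT₁.trans hT).trans ht'.le) ht'.le) (Real.exp_pos _).le
    · rw [integral_const_mul, integral_exp_mul_Ioi (neg_lt_zero.mpr hy),
        show -y * T₂ = -(T₂ * y) by ring]
      field_simp
end
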